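/- Let φ : ℂ[P₁₁₁,P₁₁₂,P₁₂₁,P₁₂₂,P₂₁₁,P₂₁₂,P₂₂₁,P₂₂₂] → ℂ[s,a₁,a₂,b₁,b₂,c₁,c₂,d₁,d₂] be the ℂ-algebra homomorphism defined on the variables by φ(P_{ijk}) = s·aᵢ·bⱼ·c_k + dᵢ when i=j=k and φ(P_{ijk}) = s·aᵢ·bⱼ·c_k otherwise, for i,j,k ∈ {1,2}. Then the kernel of φ equals the ideal generated by the two binomials P₁₂₁P₂₁₂ − P₁₁₂P₂₂₁ and P₁₂₂P₂₁₁ − P₁₂₁P₂₁₂. In particular the models QI₂ and Mix₂ have the same invariants. -/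

import Mathlib

open MvPolynomial

/-- Parameters of the (homogeneous) mixture model `Mix₂`: s, a₁, a₂, b₁, b₂, c₁, c₂, d₁, d₂. -/
inductive Param : Type
  | s : Param
  | a : Fin 2 → Param
  | b : Fin 2 → Param
  | c : Fin 2 → Param
  | d : Fin 2 → Param

/-- The parametrization map of the model `Mix₂`:
`P_{ijk} ↦ s aᵢ bⱼ c_k + dᵢ` if `i = j = k`, and `P_{ijk} ↦ s aᵢ bⱼ c_k` otherwise.
Indices in `Fin 2`: `0` stands for `1` and `1` stands for `2`. -/
noncomputable def phi : MvPolynomial (Fin 2 × Fin 2 × Fin 2) ℂ →ₐ[ℂ] MvPolynomial Param ℂ :=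
  aeval fun v : Fin 2 × Fin 2 × Fin 2 =>
    if v.1 = v.2.1 ∧ v.2.1 = v.2.2 then
      X Param.s * X (Param.a v.1) * X (Param.b v.2.1) * X (Param.c v.2.2) + X (Param.d v.1)
    else
      X Param.s * X (Param.a v.1) * X (Param.b v.2.1) * X (Param.c v.2.2)

theorem aux_nf {R : Type*} [CommRing R] (x y z u v w : R) (h1 : y * v = x * w)
    (h2 : z * u = x * w) (i j k l m n a b : ℕ) :
    x ^ i * y ^ (j + a) * z ^ (k + b) * u ^ (l + b) * v ^ (m + a) * w ^ n =
      x ^ (i + a + b) * y ^ j * z ^ k * u ^ l * v ^ m * w ^ (n + a + b) := by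
  have e1 : y ^ a * v ^ a = x ^ a * w ^ a := by rw [← mul_pow, h1, mul_pow]
  have e2 : z ^ b * u ^ b = x ^ b * w ^ b := by rw [← mul_pow, h2, mul_pow]
  calc _ = x ^ i * y ^ j * z ^ k * u ^ l * v ^ m * w ^ n * (y ^ a * v ^ a) * (z ^ b * u ^ b) := by
        ring
    _ = _ := by rw [e1, e2]; ring

theorem aux_split (j m : ℕ) : ∃ a j' m', j = j' + a ∧ m = m' + a ∧ (j' = 0 ∨ m' = 0) :=
  ⟨min j m, j - min j m, m - min j m, by omega, by omega, by omega⟩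

theorem aux_eq {R : Type*} [CommRing R] (x y z u v w : R) (h1 : y * v = x * w)
    (h2 : z * u = x * w) (i j k l m n i' j' k' l' m' n' : ℕ)
    (ha0 : i + j + k = i' + j' + k') (ha1 : l + m + n = l' + m' + n')
    (hb0 : i + l + m = i' + l' + m') (hb1 : j + k + n = j' + k' + n')
    (hc0 : j + l + n = j' + l' + n') (hc1 : i + k + m = i' + k' + m') :
    x ^ i * y ^ j * z ^ k * u ^ l * v ^ m * w ^ n =
      x ^ i' * y ^ j' * z ^ k' * u ^ l' * v ^ m' * w ^ n' := by
  obtain ⟨a, j1, m1, rfl, rfl, ho1⟩ := aux_split j m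
  obtain ⟨b, k1, l1, rfl, rfl, ho2⟩ := aux_split k l
  obtain ⟨a', j2, m2, rfl, rfl, ho3⟩ := aux_split j' m'
  obtain ⟨b', k2, l2, rfl, rfl, ho4⟩ := aux_split k' l'
  rw [aux_nf _ _ _ _ _ _ h1 h2, aux_nf _ _ _ _ _ _ h1 h2]
  have q1 : j1 = j2 := by omega
  have q2 : m1 = m2 := by omega
  have q3 : k1 = k2 := by omega
  have q4 : l1 = l2 := by omega
  have q5 : i + a + b = i' + a' + b' := by omega
  have q6 : n + a + b = n' + a' + b' := by omega
  rw [q1, q2, q3, q4, q5, q6]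

noncomputable def expo (v : Fin 2 × Fin 2 × Fin 2) : Param →₀ ℕ :=
  if v.1 = v.2.1 ∧ v.2.1 = v.2.2 then Finsupp.single (Param.d v.1) 1
  else Finsupp.single Param.s 1 + Finsupp.single (Param.a v.1) 1
    + Finsupp.single (Param.b v.2.1) 1 + Finsupp.single (Param.c v.2.2) 1

noncomputable def expoMap (m : Fin 2 × Fin 2 × Fin 2 →₀ ℕ) : Param →₀ ℕ :=
  ∑ v, m v • expo v

noncomputable def psi : MvPolynomial Param ℂ →ₐ[ℂ] MvPolynomial Param ℂ :=
  aeval fun t : Param => match t with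
    | Param.d i => X (Param.d i) - X Param.s * X (Param.a i) * X (Param.b i) * X (Param.c i)
    | t => X t

theorem psi_phi_X (v : Fin 2 × Fin 2 × Fin 2) : psi (phi (X v)) = monomial (expo v) 1 := by
  obtain ⟨i, j, k⟩ := v
  by_cases h : i = j ∧ j = k
  · obtain ⟨rfl, rfl⟩ := h
    simp [psi, phi, expo]
    rfl
  · simp [psi, phi, expo, h]
    simp [X, monomial_mul]

theorem psi_phi_monomial (m : Fin 2 × Fin 2 × Fin 2 →₀ ℕ) :
    psi (phi (monomial m 1)) = monomial (expoMap m) 1 := by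
  have : (monomial m (1:ℂ)) = ∏ v, X v ^ m v := by
    rw [monomial_eq, Finsupp.prod_fintype _ _ (by simp)]; simp
  rw [this, map_prod, map_prod, expoMap, monomial_sum_one]
  refine Finset.prod_congr rfl fun v _ => ?_
  rw [map_pow, map_pow, psi_phi_X, monomial_pow, one_pow]

noncomputable def theI : Ideal (MvPolynomial (Fin 2 × Fin 2 × Fin 2) ℂ) :=
  Ideal.span
        ({X (0, 1, 0) * X (1, 0, 1) - X (0, 0, 1) * X (1, 1, 0),
          X (0, 1, 1) * X (1, 0, 0) - X (0, 1, 0) * X (1, 0, 1)} :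
          Set (MvPolynomial (Fin 2 × Fin 2 × Fin 2) ℂ))

theorem key (m m' : Fin 2 × Fin 2 × Fin 2 →₀ ℕ) (h : expoMap m = expoMap m') :
    Ideal.Quotient.mkₐ ℂ theI (monomial m 1) = Ideal.Quotient.mkₐ ℂ theI (monomial m' 1) := by
  have hm (m : Fin 2 × Fin 2 × Fin 2 →₀ ℕ) : (monomial m (1:ℂ)) = ∏ v, X v ^ m v := by
    rw [monomial_eq, Finsupp.prod_fintype _ _ (by simp)]; simp
  have g1 : Ideal.Quotient.mkₐ ℂ theI (X (0, 1, 0) * X (1, 0, 1))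
      = Ideal.Quotient.mkₐ ℂ theI (X (0, 0, 1) * X (1, 1, 0)) :=
    Ideal.Quotient.eq.2 (Ideal.subset_span (by simp))
  have g2 : Ideal.Quotient.mkₐ ℂ theI (X (0, 1, 1) * X (1, 0, 0))
      = Ideal.Quotient.mkₐ ℂ theI (X (0, 1, 0) * X (1, 0, 1)) :=
    Ideal.Quotient.eq.2 (Ideal.subset_span (by simp))
  rw [g1] at g2
  rw [map_mul, map_mul] at g1 g2
  have ha0 := DFunLike.congr_fun h (Param.a 0)
  have ha1 := DFunLike.congr_fun h (Param.a 1)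
  have hb0 := DFunLike.congr_fun h (Param.b 0)
  have hb1 := DFunLike.congr_fun h (Param.b 1)
  have hc0 := DFunLike.congr_fun h (Param.c 0)
  have hc1 := DFunLike.congr_fun h (Param.c 1)
  have hd0 := DFunLike.congr_fun h (Param.d 0)
  have hd1 := DFunLike.congr_fun h (Param.d 1)
  simp [expoMap, expo, Fintype.sum_prod_type, Fin.sum_univ_two, Finsupp.single_apply]
    at ha0 ha1 hb0 hb1 hc0 hc1 hd0 hd1
  have := aux_eq _ _ _ _ _ _ g1 g2 (m (0,0,1)) (m (0,1,0)) (m (0,1,1)) (m (1,0,0)) (m (1,0,1))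
    (m (1,1,0)) (m' (0,0,1)) (m' (0,1,0)) (m' (0,1,1)) (m' (1,0,0)) (m' (1,0,1))
    (m' (1,1,0)) (by omega) (by omega) (by omega) (by omega) (by omega) (by omega)
  rw [hm, hm]
  simp only [map_mul, map_pow, Fintype.prod_prod_type, Fin.prod_univ_two]
  rw [hd0, hd1]
  linear_combination (Ideal.Quotient.mkₐ ℂ theI (X (0,0,0))) ^ (m' (0,0,0)) *
    (Ideal.Quotient.mkₐ ℂ theI (X (1,1,1))) ^ (m' (1,1,1)) * this

/-- The kernel of the parametrization map of `Mix₂` is generated by the two binomials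
`P₁₂₁P₂₁₂ − P₁₁₂P₂₂₁` and `P₁₂₂P₂₁₁ − P₁₂₁P₂₁₂`; in particular `QI₂` and `Mix₂` have the
same invariants. -/
theorem Mix2_invariants :
    RingHom.ker phi =
      Ideal.span
        ({X (0, 1, 0) * X (1, 0, 1) - X (0, 0, 1) * X (1, 1, 0),
          X (0, 1, 1) * X (1, 0, 0) - X (0, 1, 0) * X (1, 0, 1)} :
          Set (MvPolynomial (Fin 2 × Fin 2 × Fin 2) ℂ)) := by
  apply le_antisymm
  · intro f hf
    rw [RingHom.mem_ker] at hf
    change f ∈ theI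
    let L : MvPolynomial Param ℂ →ₗ[ℂ] (MvPolynomial (Fin 2 × Fin 2 × Fin 2) ℂ ⧸ theI) :=
      (basisMonomials Param ℂ).constr ℂ
        (fun t => Ideal.Quotient.mkₐ ℂ theI (monomial (Function.invFun expoMap t) 1))
    have hL (t) : L (monomial t 1) =
        Ideal.Quotient.mkₐ ℂ theI (monomial (Function.invFun expoMap t) 1) := by
      have := (basisMonomials Param ℂ).constr_basis ℂ
        (fun t => Ideal.Quotient.mkₐ ℂ theI (monomial (Function.invFun expoMap t) 1)) t
      rwa [coe_basisMonomials] at this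
    have hc : L ∘ₗ psi.toLinearMap ∘ₗ phi.toLinearMap
        = (Ideal.Quotient.mkₐ ℂ theI).toLinearMap := by
      refine (basisMonomials _ ℂ).ext fun m => ?_
      simp only [coe_basisMonomials, LinearMap.comp_apply, AlgHom.toLinearMap_apply]
      rw [psi_phi_monomial, hL]
      exact key _ _ (Function.invFun_eq ⟨m, rfl⟩)
    have := LinearMap.congr_fun hc f
    simp only [LinearMap.comp_apply, AlgHom.toLinearMap_apply, hf, map_zero] at this
    exact Ideal.Quotient.eq_zero_iff_mem.1 this.symm
  · rw [Ideal.span_le]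
    rintro f (rfl | rfl)
    · simp [RingHom.mem_ker, phi]; ring
    · simp [RingHom.mem_ker, phi]; ring
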